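/- Let T be a compact Hausdorff space, X a normal Hausdorff space, and q : X → Y a continuous closed surjection onto a Hausdorff space Y. If X × T is normal, then Y × T is normal. -/

import Mathlib

open Set TopologicalSpace

/-- A map `G` on ordered pairs of sets is intersection preserving on a domain `D` if
`G(A,B) ∩ G(A',B') = G(A ∩ A', B ∩ B')` for all pairs in `D`. -/
def IntersectionPreserving {T X : Type*} (D : Set (Set T × Set T))
    (G : Set T × Set T → Set X) : Prop :=
  ∀ p ∈ D, ∀ q ∈ D, G p ∩ G q = G (p.1 ∩ q.1, p.2 ∩ q.2)

/-- `S_𝓑`: the pairs `(B, D)` of members of the base with disjoint closures. -/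
def SB {T : Type*} [TopologicalSpace T] (𝓑 : Set (Set T)) : Set (Set T × Set T) :=
  {p | p.1 ∈ 𝓑 ∧ p.2 ∈ 𝓑 ∧ closure p.1 ∩ closure p.2 = ∅}

/-- `𝓑` is a base for the topology of `T` closed under (binary) unions and intersections. -/
def IsGoodBase {T : Type*} [TopologicalSpace T] (𝓑 : Set (Set T)) : Prop :=
  IsTopologicalBasis 𝓑 ∧ (∀ b ∈ 𝓑, ∀ d ∈ 𝓑, b ∪ d ∈ 𝓑) ∧ (∀ b ∈ 𝓑, ∀ d ∈ 𝓑, b ∩ d ∈ 𝓑)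

/-- `G : S_𝓑 → 𝒫(X)` is the associated map of a `𝓑`-covering of `X`: it is intersection
preserving, its values on `S_𝓑` are open, and they cover `X`. -/
def IsBCoveringMap {T X : Type*} [TopologicalSpace T] [TopologicalSpace X]
    (𝓑 : Set (Set T)) (G : Set T × Set T → Set X) : Prop :=
  IntersectionPreserving (SB 𝓑) G ∧ (∀ p ∈ SB 𝓑, IsOpen (G p)) ∧
    (⋃ p ∈ SB 𝓑, G p) = Set.univ

/-- A family `𝓖` of subsets of `X` is a `𝓑`-covering of `X` if it is the (surjective) image of
`S_𝓑` under some intersection preserving map whose values are open and cover `X`. -/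
def IsBCovering {T X : Type*} [TopologicalSpace T] [TopologicalSpace X]
    (𝓑 : Set (Set T)) (𝓖 : Set (Set X)) : Prop :=
  ∃ G : Set T × Set T → Set X, IsBCoveringMap 𝓑 G ∧ G '' (SB 𝓑) = 𝓖

/-- `G : 𝓑 × 𝓑 → 𝒫(X)` is the associated map of a pre-`𝓑`-covering of `X`: it is intersection
preserving on `𝓑 × 𝓑`, all its values on `𝓑 × 𝓑` are open, and its restriction to `S_𝓑`
is (the associated map of) a `𝓑`-covering, i.e. the values over `S_𝓑` already cover `X`. -/
def IsPreBCoveringMap {T X : Type*} [TopologicalSpace T] [TopologicalSpace X]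
    (𝓑 : Set (Set T)) (G : Set T × Set T → Set X) : Prop :=
  IntersectionPreserving (𝓑 ×ˢ 𝓑) G ∧ (∀ p ∈ 𝓑 ×ˢ 𝓑, IsOpen (G p)) ∧
    (⋃ p ∈ SB 𝓑, G p) = Set.univ

/-- A normal space: both T₄ (disjoint closed sets are separated) and Hausdorff. -/
def IsNormalHausdorff (X : Type*) [TopologicalSpace X] : Prop :=
  NormalSpace X ∧ T2Space X

/-- A perfect map: a continuous closed surjection all of whose fibers are compact. -/
def IsPerfectMap {X Y : Type*} [TopologicalSpace X] [TopologicalSpace Y] (p : X → Y) : Prop :=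
  Continuous p ∧ IsClosedMap p ∧ Function.Surjective p ∧ ∀ y : Y, IsCompact (p ⁻¹' {y})

/-- `𝓥` is a locally finite open refinement of `𝓖`: an open cover, locally finite, each of
whose members is contained in some member of `𝓖`. -/
def IsLocallyFiniteOpenRefinement {X : Type*} [TopologicalSpace X]
    (𝓖 𝓥 : Set (Set X)) : Prop :=
  (∀ v ∈ 𝓥, IsOpen v) ∧ ⋃₀ 𝓥 = Set.univ ∧
    (∀ x : X, ∃ U : Set X, IsOpen U ∧ x ∈ U ∧ {v ∈ 𝓥 | (v ∩ U).Nonempty}.Finite) ∧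
    ∀ v ∈ 𝓥, ∃ u ∈ 𝓖, v ⊆ u


/-- discrete closed families have disjoint open expansions -/
def DCW (ι : Type*) (Y : Type*) [TopologicalSpace Y] : Prop :=
  ∀ D : ι → Set Y, (∀ i, IsClosed (D i)) → LocallyFinite D →
    (∀ i j, i ≠ j → Disjoint (D i) (D j)) →
    ∃ U : ι → Set Y, (∀ i, IsOpen (U i)) ∧ (∀ i, D i ⊆ U i) ∧
      ∀ i j, i ≠ j → Disjoint (U i) (U j)

/-- countable open covers have locally finite closed shrinkings -/
def CLF (Y : Type*) [TopologicalSpace Y] : Prop :=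
  ∀ U : ℕ → Set Y, (∀ n, IsOpen (U n)) → (⋃ n, U n) = Set.univ →
    ∃ E : ℕ → Set Y, (∀ n, IsClosed (E n)) ∧ LocallyFinite E ∧ (∀ n, E n ⊆ U n) ∧
      (⋃ n, E n) = Set.univ

theorem lf_biUnion {X α ι : Type*} [TopologicalSpace X] {V : α → Set X} (hV : LocallyFinite V)
    {U : α → ι → Set X} (hU : ∀ a, LocallyFinite (U a)) :
    LocallyFinite (fun i => ⋃ a, V a ∩ U a i) := by
  intro x
  obtain ⟨N, hN, hf⟩ := hV x
  choose M hM hMf using fun a => hU a x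
  refine ⟨N ∩ ⋂ a ∈ hf.toFinset, M a, Filter.inter_mem hN ?_, ?_⟩
  · rw [Filter.biInter_finset_mem]
    intro a _
    exact hM a
  · refine Set.Finite.subset (hf.biUnion (fun a _ => hMf a)) ?_
    rintro i ⟨y, hy, hyN, hyM⟩
    simp only [mem_iUnion] at hy
    obtain ⟨a, hya, hyu⟩ := hy
    have ha : a ∈ {i | (V i ∩ N).Nonempty} := ⟨y, hya, hyN⟩
    simp only [mem_iUnion]
    refine ⟨a, ha, y, hyu, ?_⟩
    simp only [mem_iInter] at hyM
    exact hyM a (by simpa using ha)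

theorem isOpen_forall_compact {A B : Type*} [TopologicalSpace A] [TopologicalSpace B]
    {K : Set B} (hK : IsCompact K) {N : Set (A × B)} (hN : IsOpen N) :
    IsOpen {a | ∀ b ∈ K, (a, b) ∈ N} := by
  rw [isOpen_iff_mem_nhds]
  intro a ha
  exact hK.eventually_forall_of_forall_eventually (P := fun a b => (a, b) ∈ N)
    (fun b hb => hN.mem_nhds (ha b hb))

theorem normal_of_closed_map {X Y : Type*} [TopologicalSpace X] [TopologicalSpace Y]
    [NormalSpace X] (q : X → Y) (hqc : Continuous q) (hqcl : IsClosedMap q)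
    (hqs : Function.Surjective q) : NormalSpace Y := by
  refine ⟨fun s t hs ht hst => ?_⟩
  obtain ⟨U, V, hU, hV, hsU, htV, hUV⟩ := normal_separation (hs.preimage hqc) (ht.preimage hqc)
    (hst.preimage q)
  refine ⟨(q '' Uᶜ)ᶜ, (q '' Vᶜ)ᶜ, (hqcl _ hU.isClosed_compl).isOpen_compl,
    (hqcl _ hV.isClosed_compl).isOpen_compl, ?_, ?_, ?_⟩
  · rintro y hy ⟨x, hx, rfl⟩
    exact hx (hsU hy)
  · rintro y hy ⟨x, hx, rfl⟩
    exact hx (htV hy)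
  · rw [Set.disjoint_left]
    intro y hy hy'
    obtain ⟨x, rfl⟩ := hqs y
    have h1 : x ∈ U := by
      by_contra h
      exact hy ⟨x, h, rfl⟩
    have h2 : x ∈ V := by
      by_contra h
      exact hy' ⟨x, h, rfl⟩
    exact Set.disjoint_left.1 hUV h1 h2

theorem DCW.of_closed_map {ι X Y : Type*} [TopologicalSpace X] [TopologicalSpace Y]
    (h : DCW ι X) (q : X → Y) (hqc : Continuous q) (hqcl : IsClosedMap q)
    (hqs : Function.Surjective q) : DCW ι Y := by
  intro D hD hlf hdis
  obtain ⟨U, hU, hDU, hUd⟩ := h (fun i => q ⁻¹' D i) (fun i => (hD i).preimage hqc)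
    (hlf.preimage_continuous hqc) (fun i j hij => (hdis i j hij).preimage q)
  refine ⟨fun i => (q '' (U i)ᶜ)ᶜ, fun i => (hqcl _ (hU i).isClosed_compl).isOpen_compl, ?_, ?_⟩
  · rintro i y hy ⟨x, hx, rfl⟩
    exact hx (hDU i hy)
  · intro i j hij
    rw [Set.disjoint_left]
    intro y hy hy'
    obtain ⟨x, rfl⟩ := hqs y
    have h1 : x ∈ U i := by
      by_contra h
      exact hy ⟨x, h, rfl⟩
    have h2 : x ∈ U j := by
      by_contra h
      exact hy' ⟨x, h, rfl⟩
    exact Set.disjoint_left.1 (hUd i j hij) h1 h2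

theorem lf_extend {α β X : Type*} [TopologicalSpace X] (f : α → β) (hf : Function.Injective f)
    {D : α → Set X} (hD : LocallyFinite D) :
    LocallyFinite (fun b => ⋃ a, ⋃ (_ : f a = b), D a) := by
  intro x
  obtain ⟨N, hN, hfin⟩ := hD x
  refine ⟨N, hN, (hfin.image f).subset ?_⟩
  rintro b ⟨y, hy, hyN⟩
  simp only [mem_iUnion] at hy
  obtain ⟨a, rfl, hy⟩ := hy
  exact ⟨a, ⟨y, hy, hyN⟩, rfl⟩

theorem DCW.of_injective {α β X : Type*} [TopologicalSpace X] (h : DCW β X)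
    (f : α → β) (hf : Function.Injective f) : DCW α X := by
  intro D hD hlf hdis
  have key : ∀ a, (⋃ a', ⋃ (_ : f a' = f a), D a') = D a := by
    intro a
    ext x
    simp only [mem_iUnion]
    constructor
    · rintro ⟨a', h', hx⟩
      rwa [← hf h']
    · intro hx
      exact ⟨a, rfl, hx⟩
  obtain ⟨U, hU, hDU, hUd⟩ := h (fun b => ⋃ a, ⋃ (_ : f a = b), D a) (by
      intro b
      by_cases hb : ∃ a, f a = b
      · obtain ⟨a, rfl⟩ := hb
        rw [key a]
        exact hD a
      · have : (⋃ a, ⋃ (_ : f a = b), D a) = ∅ := by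
          ext x
          simp only [mem_iUnion, mem_empty_iff_false, iff_false]
          rintro ⟨a, h', _⟩
          exact hb ⟨a, h'⟩
        rw [this]
        exact isClosed_empty) (lf_extend f hf hlf) (by
      intro b b' hbb
      rw [Set.disjoint_left]
      intro x hx hx'
      simp only [mem_iUnion] at hx hx'
      obtain ⟨a, rfl, hx⟩ := hx
      obtain ⟨a', rfl, hx'⟩ := hx'
      exact Set.disjoint_left.1 (hdis a a' (fun h => hbb (by rw [h]))) hx hx')
  refine ⟨fun a => U (f a), fun a => hU _, fun a => ?_, fun a a' haa => hUd _ _ (hf.ne haa)⟩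
  have := hDU (f a)
  rwa [key a] at this

theorem closed_others {ι X : Type*} [TopologicalSpace X] {D : ι → Set X}
    (hD : ∀ i, IsClosed (D i)) (hlf : LocallyFinite D) (p : ι → Prop) :
    IsClosed (⋃ i, ⋃ (_ : p i), D i) := by
  refine LocallyFinite.isClosed_iUnion (hlf.subset (fun i => iUnion_subset fun _ => subset_rfl)) ?_
  intro i
  by_cases h : p i
  · simpa [h] using hD i
  · simp [h]

theorem exists_sep {ι X : Type*} [TopologicalSpace X] [NormalSpace X] {D : ι → Set X}
    (hD : ∀ i, IsClosed (D i)) (hlf : LocallyFinite D)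
    (hdis : ∀ i j, i ≠ j → Disjoint (D i) (D j)) (V : ι → Set X) (hV : ∀ i, IsOpen (V i))
    (hDV : ∀ i, D i ⊆ V i) :
    ∃ G : ι → Set X, (∀ i, IsOpen (G i)) ∧ (∀ i, D i ⊆ G i) ∧ (∀ i, closure (G i) ⊆ V i) ∧
      ∀ i j, i ≠ j → Disjoint (closure (G i)) (D j) := by
  have : ∀ i, ∃ G, IsOpen G ∧ D i ⊆ G ∧ closure G ⊆ V i ∩ (⋃ j, ⋃ (_ : j ≠ i), D j)ᶜ := by
    intro i
    refine normal_exists_closure_subset (hD i) ((hV i).inter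
      (closed_others hD hlf _).isOpen_compl) (subset_inter (hDV i) ?_)
    intro x hx hx'
    simp only [mem_iUnion] at hx'
    obtain ⟨j, hj, hx'⟩ := hx'
    exact Set.disjoint_left.1 (hdis j i hj) hx' hx
  choose G hG h1 h2 using this
  refine ⟨G, hG, h1, fun i => (h2 i).trans inter_subset_left, fun i j hij => ?_⟩
  rw [Set.disjoint_left]
  intro x hx hx'
  exact (h2 i hx).2 (mem_iUnion.2 ⟨j, mem_iUnion.2 ⟨hij.symm, hx'⟩⟩)

theorem DCW_of_lf {ι X : Type*} [TopologicalSpace X] [NormalSpace X]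
    (h : ∀ D : ι → Set X, (∀ i, IsClosed (D i)) → LocallyFinite D →
    (∀ i j, i ≠ j → Disjoint (D i) (D j)) →
    ∃ U : ι → Set X, (∀ i, IsOpen (U i)) ∧ (∀ i, D i ⊆ U i) ∧ LocallyFinite U) : DCW ι X := by
  intro D hD hlf hdis
  obtain ⟨U, hU, hDU, hUlf⟩ := h D hD hlf hdis
  obtain ⟨G, hG, hDG, hGU, hGD⟩ := exists_sep hD hlf hdis U hU hDU
  have hGlf : LocallyFinite (fun i => closure (G i)) := hUlf.subset hGU
  refine ⟨fun i => G i ∩ (⋃ j, ⋃ (_ : j ≠ i), closure (G j))ᶜ, fun i => (hG i).inter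
    (closed_others (fun i => isClosed_closure) hGlf _).isOpen_compl, fun i => ?_, ?_⟩
  · refine subset_inter (hDG i) ?_
    intro x hx hx'
    simp only [mem_iUnion] at hx'
    obtain ⟨j, hj, hx'⟩ := hx'
    exact Set.disjoint_left.1 (hGD j i hj) hx' hx
  · intro i j hij
    rw [Set.disjoint_left]
    rintro x ⟨hx, _⟩ ⟨_, hx'⟩
    exact hx' (mem_iUnion.2 ⟨i, mem_iUnion.2 ⟨hij, subset_closure hx⟩⟩)

theorem DCW_nat {X : Type*} [TopologicalSpace X] [NormalSpace X] : DCW ℕ X := by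
  intro D hD hlf hdis
  obtain ⟨G, hG, hDG, -, hGD⟩ := exists_sep hD hlf hdis (fun _ => univ) (fun _ => isOpen_univ)
    (fun _ => subset_univ _)
  have hc : ∀ n, IsClosed (⋃ k ∈ Finset.range n, closure (G k)) := fun n =>
    isClosed_biUnion_finset (fun i _ => isClosed_closure)
  have main : ∀ i j, i < j → Disjoint (G i ∩ (⋃ k ∈ Finset.range i, closure (G k))ᶜ)
      (G j ∩ (⋃ k ∈ Finset.range j, closure (G k))ᶜ) := by
    intro i j hij
    rw [Set.disjoint_left]
    rintro x ⟨hx, _⟩ ⟨_, hx'⟩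
    exact hx' (mem_biUnion (by simpa using hij) (subset_closure hx))
  refine ⟨fun n => G n ∩ (⋃ k ∈ Finset.range n, closure (G k))ᶜ, fun n => (hG n).inter
    (hc n).isOpen_compl, fun n => subset_inter (hDG n) ?_, ?_⟩
  · intro x hx hx'
    simp only [mem_iUnion, Finset.mem_range] at hx'
    obtain ⟨j, hj, hx'⟩ := hx'
    exact Set.disjoint_left.1 (hGD j n hj.ne) hx' hx
  · intro i j hij
    rcases lt_or_gt_of_ne hij with h | h
    · exact main i j h
    · exact (main j i h).symm

/-- discrete expansion -/
theorem DCW.expand {ι Y : Type*} [TopologicalSpace Y] [NormalSpace Y] (h : DCW ι Y)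
    {D : ι → Set Y} (hD : ∀ i, IsClosed (D i)) (hlf : LocallyFinite D)
    (hdis : ∀ i j, i ≠ j → Disjoint (D i) (D j)) (V : ι → Set Y) (hV : ∀ i, IsOpen (V i))
    (hDV : ∀ i, D i ⊆ V i) :
    ∃ U : ι → Set Y, (∀ i, IsOpen (U i)) ∧ (∀ i, D i ⊆ U i) ∧ (∀ i, closure (U i) ⊆ V i) ∧
      LocallyFinite (fun i => closure (U i)) := by
  obtain ⟨O, hO, hDO, hOd⟩ := h D hD hlf hdis
  obtain ⟨G, hG, hDG, hGV, -⟩ := exists_sep hD hlf hdis V hV hDV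
  obtain ⟨P, hP, hDP, hPO⟩ := normal_exists_closure_subset (hlf.isClosed_iUnion hD)
    (isOpen_iUnion hO) (iUnion_mono hDO)
  refine ⟨fun i => G i ∩ O i ∩ P, fun i => ((hG i).inter (hO i)).inter hP,
    fun i => subset_inter (subset_inter (hDG i) (hDO i))
      ((subset_iUnion D i).trans hDP), fun i => ?_, ?_⟩
  · exact (closure_mono (inter_subset_left.trans inter_subset_left)).trans (hGV i)
  · apply LocallyFinite.closure
    intro y
    by_cases hy : y ∈ closure P
    · obtain ⟨i, hi⟩ := mem_iUnion.1 (hPO hy)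
      refine ⟨O i, (hO i).mem_nhds hi, (Set.finite_singleton i).subset ?_⟩
      rintro j ⟨z, ⟨⟨_, hz⟩, _⟩, hz'⟩
      by_contra hji
      exact Set.disjoint_left.1 (hOd j i hji) hz hz'
    · refine ⟨(closure P)ᶜ, isClosed_closure.isOpen_compl.mem_nhds hy, ?_⟩
      convert Set.finite_empty
      ext j
      simp only [mem_setOf_eq, mem_empty_iff_false, iff_false]
      rintro ⟨z, ⟨_, hz⟩, hz'⟩
      exact hz' (subset_closure hz)

theorem CLF_of_incr {Y : Type*} [TopologicalSpace Y] [NormalSpace Y]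
    (h : ∀ V : ℕ → Set Y, (∀ n, IsOpen (V n)) → Monotone V → (⋃ n, V n) = Set.univ →
      ∃ F : ℕ → Set Y, (∀ n, IsClosed (F n)) ∧ (∀ n, F n ⊆ V n) ∧ (⋃ n, F n) = Set.univ) :
    CLF Y := by
  classical
  intro U hU hcov
  obtain ⟨F, hF, hFV, hFc⟩ := h (fun n => ⋃ k ∈ Set.Iic n, U k)
    (fun n => isOpen_biUnion fun k _ => hU k)
    (fun m n hmn => biUnion_subset_biUnion_left (Set.Iic_subset_Iic.2 hmn)) (by
      rw [eq_univ_iff_forall] at hcov ⊢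
      intro x
      obtain ⟨n, hn⟩ := mem_iUnion.1 (hcov x)
      exact mem_iUnion.2 ⟨n, mem_biUnion (Set.mem_Iic.2 le_rfl) hn⟩)
  choose G hG hFG hGV using fun n => normal_exists_closure_subset (hF n)
    (isOpen_biUnion fun k (_ : k ∈ Set.Iic n) => hU k) (hFV n)
  let L : ℕ → Set Y := fun n => U n ∩ (⋃ k ∈ Finset.range n, closure (G k))ᶜ
  have hL : ∀ n, IsOpen (L n) := fun n => (hU n).inter
    (isClosed_biUnion_finset (fun i _ => isClosed_closure)).isOpen_compl
  have hLlf : LocallyFinite L := by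
    intro y
    obtain ⟨m, hm⟩ := mem_iUnion.1 (hFc.ge (mem_univ y))
    refine ⟨G m, (hG m).mem_nhds (hFG m hm), (Set.finite_Iic m).subset ?_⟩
    rintro n ⟨z, ⟨_, hz⟩, hz'⟩
    by_contra hn
    exact hz (mem_biUnion (by simpa using hn) (subset_closure hz'))
  have hLc : ⋃ n, L n = univ := by
    rw [eq_univ_iff_forall]
    intro y
    have hex : ∃ n, y ∈ U n := mem_iUnion.1 (hcov.ge (mem_univ y))
    refine mem_iUnion.2 ⟨Nat.find hex, Nat.find_spec hex, ?_⟩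
    intro hy
    simp only [mem_iUnion, Finset.mem_range] at hy
    obtain ⟨k, hk, hy⟩ := hy
    have := hGV k hy
    simp only [mem_iUnion, mem_Iic] at this
    obtain ⟨l, hl, hy'⟩ := this
    exact Nat.find_min hex (lt_of_le_of_lt hl hk) hy'
  obtain ⟨E, hEc, hEcl, hEL⟩ := exists_iUnion_eq_closed_subset hL hLlf.point_finite hLc
  exact ⟨E, hEcl, hLlf.subset hEL, fun n => (hEL n).trans inter_subset_left, hEc⟩

theorem CLF.of_closed_map {X Y : Type*} [TopologicalSpace X] [TopologicalSpace Y] [NormalSpace Y]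
    (h : CLF X) (q : X → Y) (hqc : Continuous q) (hqcl : IsClosedMap q)
    (hqs : Function.Surjective q) : CLF Y := by
  refine CLF_of_incr fun V hV _ hc => ?_
  obtain ⟨E, hE, -, hEV, hEc⟩ := h (fun n => q ⁻¹' V n) (fun n => (hV n).preimage hqc) (by
    rw [← preimage_iUnion, hc, preimage_univ])
  refine ⟨fun n => q '' E n, fun n => hqcl _ (hE n), fun n => image_subset_iff.2 (hEV n), ?_⟩
  rw [← image_iUnion, hEc, image_univ, hqs.range_eq]

theorem CLF.rel {Y : Type*} [TopologicalSpace Y] (h : CLF Y) {R : Set Y} (hR : IsClosed R)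
    (U : ℕ → Set Y) (hU : ∀ n, IsOpen (U n)) (hRU : R ⊆ ⋃ n, U n) :
    ∃ E : ℕ → Set Y, (∀ n, IsClosed (E n)) ∧ LocallyFinite E ∧ (∀ n, E n ⊆ U n) ∧
      R ⊆ interior (⋃ n, E n) := by
  obtain ⟨E, hE, hlf, hEU, hc⟩ := h (fun n => Nat.casesOn n Rᶜ U) (by
    rintro (_ | n)
    · exact hR.isOpen_compl
    · exact hU n) (by
    rw [eq_univ_iff_forall]
    intro y
    by_cases hy : y ∈ R
    · obtain ⟨n, hn⟩ := mem_iUnion.1 (hRU hy)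
      exact mem_iUnion.2 ⟨n + 1, hn⟩
    · exact mem_iUnion.2 ⟨0, hy⟩)
  refine ⟨fun n => E (n + 1), fun n => hE _, hlf.comp_injective (Nat.succ_injective),
    fun n => hEU (n + 1), ?_⟩
  refine Subset.trans ?_ (interior_maximal (s := ⋃ n, E (n+1)) (t := (E 0)ᶜ) ?_
    (hE 0).isOpen_compl)
  · intro y hy hy'
    exact hEU 0 hy' hy
  · intro y hy
    obtain ⟨n, hn⟩ := mem_iUnion.1 (hc.ge (mem_univ y))
    cases n with
    | zero => exact absurd hn hy
    | succ n => exact mem_iUnion.2 ⟨n, hn⟩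

/-- part of `O γ` missing the earlier images -/
def WW {X Y Γ : Type*} [LT Γ] (q : X → Y) (F : Γ → Set X) (O : Γ → Set Y) (γ : Γ) : Set Y :=
  O γ \ q '' (⋃ ε, ⋃ (_ : ε < γ), F ε)

theorem isOpen_WW {X Y Γ : Type*} [LT Γ] [TopologicalSpace X] [TopologicalSpace Y] {q : X → Y}
    (hqcl : IsClosedMap q) {F : Γ → Set X} {O : Γ → Set Y} (hF : ∀ γ, IsClosed (F γ))
    (hlf : LocallyFinite F) (hO : ∀ γ, IsOpen (O γ)) (γ : Γ) : IsOpen (WW q F O γ) :=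
  (hO γ).sdiff (hqcl _ (closed_others hF hlf _))

theorem notMem_of_WW {X Y Γ : Type*} [LT Γ] {q : X → Y} {F : Γ → Set X} {O : Γ → Set Y} {γ ε : Γ}
    (h : ε < γ) {y : Y} (hy : y ∈ WW q F O γ) : y ∉ q '' F ε := by
  rintro ⟨x, hx, rfl⟩
  exact hy.2 ⟨x, mem_iUnion.2 ⟨ε, mem_iUnion.2 ⟨h, hx⟩⟩, rfl⟩

/-- good system -/
def Sys {X Y Γ : Type*} [TopologicalSpace X] [TopologicalSpace Y] (q : X → Y) (J : Set Γ)
    (F : Γ → Set X) (O : Γ → Set Y) : Prop :=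
  (∀ γ, IsClosed (F γ)) ∧ LocallyFinite F ∧ (∀ γ, IsOpen (O γ)) ∧ (∀ γ, q '' F γ ⊆ O γ) ∧
    ∀ γ, γ ∉ J → F γ = ∅

/-- the claim proved by transfinite induction -/
def Sst {X Y Γ : Type*} [TopologicalSpace X] [TopologicalSpace Y] [LT Γ] (q : X → Y)
    (J : Set Γ) : Prop :=
  ∀ (F : Γ → Set X) (O : Γ → Set Y), Sys q J F O →
    ∃ E : Γ → Set Y, (∀ γ, IsClosed (E γ)) ∧ LocallyFinite E ∧ (∀ γ, E γ ⊆ WW q F O γ) ∧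
      (∀ γ, γ ∉ J → E γ = ∅) ∧ q '' (⋃ γ, F γ) ⊆ interior (⋃ γ, E γ)

/-- restriction to an index set -/
def rest {X Γ : Type*} (F : Γ → Set X) (J : Set Γ) (γ : Γ) : Set X := {x | x ∈ F γ ∧ γ ∈ J}

theorem Sys.rest {X Y Γ : Type*} [TopologicalSpace X] [TopologicalSpace Y] {q : X → Y} {J : Set Γ}
    {F : Γ → Set X} {O : Γ → Set Y} (h : Sys q J F O) (J' : Set Γ) :
    Sys q J' (rest F J') O := by
  obtain ⟨h1, h2, h3, h4, h5⟩ := h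
  refine ⟨fun γ => ?_, h2.subset fun γ x hx => hx.1, h3, fun γ =>
    (image_mono fun x hx => hx.1).trans (h4 γ), fun γ hγ => ?_⟩
  · by_cases h : γ ∈ J'
    · have : _root_.rest F J' γ = F γ := by ext x; simp [_root_.rest, h]
      rw [this]; exact h1 γ
    · have : _root_.rest F J' γ = ∅ := by ext x; simp [_root_.rest, h]
      rw [this]; exact isClosed_empty
  · ext x; simp [_root_.rest, hγ]

theorem WW_rest {X Y Γ : Type*} [Preorder Γ] {q : X → Y} {F : Γ → Set X} {O : Γ → Set Y}
    {J : Set Γ} (hJ : IsLowerSet J) {γ : Γ} (hγ : γ ∈ J) :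
    WW q (rest F J) O γ = WW q F O γ := by
  unfold WW
  congr 2
  refine iUnion_congr fun ε => iUnion_congr fun hε => ?_
  ext x
  simp [rest, hJ hε.le hγ]

theorem Sst.succ {X Y Γ : Type*} [TopologicalSpace X] [TopologicalSpace Y] [NormalSpace Y]
    [LinearOrder Γ] {q : X → Y} (hqcl : IsClosedMap q) {j : Γ}
    (h : Sst q (Set.Iio j)) : Sst q (Set.Iic j) := by
  intro F O hS
  obtain ⟨E', hE', hElf, hEW, hE0, hEc⟩ := h _ _ (hS.rest (Set.Iio j))
  have hEW' : ∀ γ, E' γ ⊆ WW q F O γ := by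
    intro γ
    by_cases hγ : γ ∈ Set.Iio j
    · rw [← WW_rest (isLowerSet_Iio j) hγ]; exact hEW γ
    · rw [hE0 γ hγ]; exact empty_subset _
  obtain ⟨hF, hlf, hO, hFO, hF0⟩ := hS
  obtain ⟨G, hG, hBG, hGW⟩ := normal_exists_closure_subset
    ((hqcl _ (hF j)).sdiff (isOpen_interior (s := ⋃ γ, E' γ))) (isOpen_WW hqcl hF hlf hO j) (by
      rintro y ⟨hy, hy'⟩
      refine ⟨hFO j hy, ?_⟩
      rintro ⟨x, hx, rfl⟩
      simp only [mem_iUnion] at hx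
      obtain ⟨ε, hε, hx⟩ := hx
      exact hy' (hEc ⟨x, mem_iUnion.2 ⟨ε, hx, hε⟩, rfl⟩))
  refine ⟨fun γ => E' γ ∪ {y | y ∈ closure G ∧ γ = j}, fun γ => ?_, ?_, ?_, ?_, ?_⟩
  · refine (hE' γ).union ?_
    by_cases hγ : γ = j
    · simpa [hγ] using isClosed_closure
    · simp [hγ]
  · intro y
    obtain ⟨N, hN, hf⟩ := hElf y
    refine ⟨N, hN, (hf.union (Set.finite_singleton j)).subset ?_⟩
    rintro γ ⟨z, hz | hz, hzN⟩
    · exact Or.inl ⟨z, hz, hzN⟩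
    · exact Or.inr hz.2
  · rintro γ y (hy | ⟨hy, rfl⟩)
    · exact hEW' γ hy
    · exact hGW hy
  · intro γ hγ
    have h1 : γ ∉ Set.Iio j := fun h => hγ (le_of_lt h)
    have h2 : γ ≠ j := fun h => hγ (le_of_eq h)
    simp [hE0 γ h1, h2]
  · rintro y ⟨x, hx, rfl⟩
    obtain ⟨γ, hx⟩ := mem_iUnion.1 hx
    by_cases hi : q x ∈ interior (⋃ γ, E' γ)
    · exact interior_mono (iUnion_mono fun γ => subset_union_left) hi
    · have hγ : γ ≤ j := by
        by_contra hγ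
        rw [hF0 γ hγ] at hx
        exact hx
      rcases hγ.lt_or_eq with hγ | rfl
      · exact absurd (hEc ⟨x, mem_iUnion.2 ⟨γ, hx, hγ⟩, rfl⟩) hi
      · refine interior_maximal (t := G) ?_ hG (hBG ⟨⟨x, hx, rfl⟩, hi⟩)
        intro z hz
        exact mem_iUnion.2 ⟨γ, Or.inr ⟨subset_closure hz, rfl⟩⟩

theorem michael_one {X Y Γ : Type*} [TopologicalSpace X] [TopologicalSpace Y]
    [LinearOrder Γ] {q : X → Y} (hqc : Continuous q) (hqcl : IsClosedMap q) {J : Set Γ}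
    (hJ : IsLowerSet J) (h : ∀ j ∈ J, Sst q (Set.Iic j)) (F : Γ → Set X) (O : Γ → Set Y)
    (hS : Sys q J F O) :
    ∃ F' : Γ → Set X, Sys q J F' (WW q F O) ∧ (⋃ γ, F' γ) = ⋃ γ, F γ := by
  choose E hE hElf hEW hE0 hEc using fun j : J => h j j.2 _ _ (hS.rest (Set.Iic j.1))
  have hEW' : ∀ j γ, E j γ ⊆ WW q F O γ := by
    intro j γ
    by_cases hγ : γ ∈ Set.Iic j.1
    · rw [← WW_rest (isLowerSet_Iic j.1) hγ]; exact hEW j γ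
    · rw [hE0 j γ hγ]; exact empty_subset _
  obtain ⟨hF, hlf, hO, hFO, hF0⟩ := hS
  have hlfJ : LocallyFinite (fun j : J => F j) := hlf.comp_injective Subtype.val_injective
  refine ⟨fun γ => ⋃ j : J, F j ∩ q ⁻¹' E j γ, ⟨fun γ => ?_, ?_, isOpen_WW hqcl hF hlf hO, ?_, ?_⟩,
    ?_⟩
  · exact (hlfJ.subset fun j => inter_subset_left).isClosed_iUnion
      fun j => (hF j).inter ((hE j γ).preimage hqc)
  · exact lf_biUnion hlfJ (U := fun j γ => q ⁻¹' E j γ) fun j => (hElf j).preimage_continuous hqc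
  · rintro γ y ⟨x, hx, rfl⟩
    obtain ⟨j, hx⟩ := mem_iUnion.1 hx
    exact hEW' j γ hx.2
  · intro γ hγ
    rw [iUnion_eq_empty]
    intro j
    rw [hE0 j γ (fun h => hγ (hJ h j.2))]
    simp
  · apply Subset.antisymm
    · refine iUnion_subset fun γ => iUnion_subset fun j => ?_
      exact inter_subset_left.trans (subset_iUnion F j)
    · refine iUnion_subset fun γ x hx => ?_
      have hγ : γ ∈ J := by
        by_contra hγ
        rw [hF0 γ hγ] at hx
        exact hx
      have := interior_subset (hEc ⟨γ, hγ⟩ ⟨x, mem_iUnion.2 ⟨γ, hx, le_refl γ⟩, rfl⟩)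
      obtain ⟨ε, hε⟩ := mem_iUnion.1 this
      exact mem_iUnion.2 ⟨ε, mem_iUnion.2 ⟨⟨γ, hγ⟩, hx, hε⟩⟩

theorem michael_lim {X Y Γ : Type*} [TopologicalSpace X] [TopologicalSpace Y] [NormalSpace Y]
    [LinearOrder Γ] [WellFoundedLT Γ] {q : X → Y} (hqc : Continuous q) (hqcl : IsClosedMap q)
    (hC : CLF Y) (hD : DCW Γ Y) {J : Set Γ}
    (hJ : IsLowerSet J) (h : ∀ j ∈ J, Sst q (Set.Iic j)) : Sst q J := by
  intro F O hS
  -- the sequence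
  have hstep : ∀ p : {p : (Γ → Set X) × (Γ → Set Y) // Sys q J p.1 p.2},
      ∃ p' : {p : (Γ → Set X) × (Γ → Set Y) // Sys q J p.1 p.2},
        p'.1.2 = WW q p.1.1 p.1.2 ∧ (⋃ γ, p'.1.1 γ) = ⋃ γ, p.1.1 γ := by
    rintro ⟨⟨F, O⟩, hp⟩
    obtain ⟨F', h1, h2⟩ := michael_one hqc hqcl hJ h F O hp
    exact ⟨⟨(F', WW q F O), h1⟩, rfl, h2⟩
  choose st hst1 hst2 using hstep
  let s : ℕ → {p : (Γ → Set X) × (Γ → Set Y) // Sys q J p.1 p.2} := fun n =>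
    st^[n] ⟨(F, O), hS⟩
  have hs0 : s 0 = ⟨(F, O), hS⟩ := rfl
  have hs : ∀ n, s (n + 1) = st (s n) := fun n => Function.iterate_succ_apply' st n _
  let A : ℕ → Γ → Set X := fun n => (s n).1.1
  let B : ℕ → Γ → Set Y := fun n => (s n).1.2
  have hSys : ∀ n, Sys q J (A n) (B n) := fun n => (s n).2
  have hB : ∀ n, B (n + 1) = WW q (A n) (B n) := by
    intro n
    change (s (n + 1)).1.2 = _
    rw [hs]
    exact hst1 _
  have hA : ∀ n, (⋃ γ, A n γ) = ⋃ γ, F γ := by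
    intro n
    induction n with
    | zero => rfl
    | succ n ih =>
      rw [← ih]
      change (⋃ γ, (s (n + 1)).1.1 γ) = _
      rw [hs]
      exact hst2 _
  have hBsub : ∀ n γ, B (n + 1) γ ⊆ WW q F O γ := by
    intro n
    induction n with
    | zero => intro γ; rw [hB]; exact subset_rfl
    | succ n ih =>
      intro γ
      rw [hB]
      exact sdiff_subset.trans (ih γ)
  clear_value A B
  let C : ℕ → Γ → Set Y := fun n γ => q '' A (n + 1) γ
  have hCW : ∀ n γ, C n γ ⊆ WW q F O γ := fun n γ => ((hSys (n + 1)).2.2.2.1 γ).trans (hBsub n γ)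
  have hCcl : ∀ n (p : Γ → Prop), IsClosed (⋃ γ, ⋃ (_ : p γ), C n γ) := by
    intro n p
    have := hqcl _ (closed_others (hSys (n + 1)).1 (hSys (n + 1)).2.1 p)
    simpa only [image_iUnion] using this
  have hCcov : ∀ n, ∀ y ∈ q '' (⋃ γ, F γ), ∃ γ, y ∈ C n γ := by
    rintro n y ⟨x, hx, rfl⟩
    rw [← hA (n + 1)] at hx
    obtain ⟨γ, hγ⟩ := mem_iUnion.1 hx
    exact ⟨γ, x, hγ, rfl⟩
  have hCC : ∀ n γ ε, ε < γ → ∀ y, y ∈ C (n + 1) γ → y ∉ C n ε := by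
    intro n γ ε hε y hy
    have := (hSys (n + 1 + 1)).2.2.2.1 γ hy
    rw [hB] at this
    exact notMem_of_WW hε this
  let U : ℕ → Γ → Set Y := fun n γ => (⋃ ε, ⋃ (_ : ε ≠ γ), C n ε)ᶜ
  have hU : ∀ n γ, IsOpen (U n γ) := fun n γ => (hCcl n _).isOpen_compl
  have hR : IsClosed (q '' (⋃ γ, F γ)) := hqcl _ (hS.2.1.isClosed_iUnion hS.1)
  have hcov : q '' (⋃ γ, F γ) ⊆ ⋃ n, ⋃ γ, U n γ := by
    intro y hy
    obtain ⟨γ, ⟨n, hn⟩, hmin⟩ := WellFounded.has_min (r := fun a b : Γ => a < b) wellFounded_lt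
      {γ | ∃ n, y ∈ C n γ} (let ⟨γ, h⟩ := hCcov 0 y hy; ⟨γ, 0, h⟩)
    refine mem_iUnion.2 ⟨n + 1, mem_iUnion.2 ⟨γ, ?_⟩⟩
    intro hy'
    simp only [mem_iUnion] at hy'
    obtain ⟨ε, hε, hy'⟩ := hy'
    rcases lt_or_gt_of_ne hε with h1 | h1
    · exact hmin ε ⟨n + 1, hy'⟩ h1
    · exact hCC n ε γ h1 y hy' hn
  obtain ⟨Z, hZ, hZlf, hZU, hZc⟩ := hC.rel hR _ (fun n => isOpen_iUnion (hU n)) hcov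
  have hone : ∀ n γ ε y, y ∈ U n γ → y ∈ C n ε → ε = γ := by
    intro n γ ε y h1 h2
    by_contra hne
    exact h1 (mem_iUnion.2 ⟨ε, mem_iUnion.2 ⟨hne, h2⟩⟩)
  have hCcl1 : ∀ n γ, IsClosed (C n γ) := fun n γ => hqcl _ ((hSys (n + 1)).1 γ)
  have hex : ∀ n, ∃ V : Γ → Set Y, (∀ i, IsOpen (V i)) ∧ (∀ i, Z n ∩ C n i ⊆ V i) ∧
      (∀ i, closure (V i) ⊆ {y | y ∈ WW q F O i ∧ i ∈ J}) ∧
      LocallyFinite (fun i => closure (V i)) := by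
    intro n
    refine hD.expand (fun γ => (hZ n).inter (hCcl1 n γ)) ?_ ?_ _
      (fun i => ?_) (fun γ => ?_)
    · intro y
      by_cases hy : y ∈ Z n
      · obtain ⟨γ, hγ⟩ := mem_iUnion.1 (hZU n hy)
        refine ⟨U n γ, (hU n γ).mem_nhds hγ, (Set.finite_singleton γ).subset ?_⟩
        rintro ε ⟨z, ⟨_, hz⟩, hz'⟩
        exact hone n γ ε z hz' hz
      · refine ⟨(Z n)ᶜ, (hZ n).isOpen_compl.mem_nhds hy, Set.finite_empty.subset ?_⟩
        rintro ε ⟨z, ⟨hz, _⟩, hz'⟩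
        exact hz' hz
    · intro γ ε hne
      rw [Set.disjoint_left]
      rintro y ⟨hy, h1⟩ ⟨_, h2⟩
      obtain ⟨δ, hδ⟩ := mem_iUnion.1 (hZU n hy)
      exact hne ((hone n δ γ y hδ h1).trans (hone n δ ε y hδ h2).symm)
    · by_cases hi : i ∈ J
      · have : {y | y ∈ WW q F O i ∧ i ∈ J} = WW q F O i := by ext y; simp [hi]
        rw [this]
        exact isOpen_WW hqcl hS.1 hS.2.1 hS.2.2.1 i
      · have : {y | y ∈ WW q F O i ∧ i ∈ J} = ∅ := by ext y; simp [hi]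
        rw [this]
        exact isOpen_empty
    · rintro y ⟨_, hy⟩
      refine ⟨hCW n γ hy, ?_⟩
      by_contra hγ
      obtain ⟨x, hx, _⟩ := hy
      rw [(hSys (n + 1)).2.2.2.2 γ hγ] at hx
      exact hx
  choose V hV hZV hVW hVlf using hex
  obtain ⟨E, hE, hElf, hEV, hEc⟩ := hC.rel hR (fun n => ⋃ γ, V n γ)
    (fun n => isOpen_iUnion (hV n)) (by
      intro y hy
      obtain ⟨n, hn⟩ := mem_iUnion.1 (interior_subset (hZc hy))
      obtain ⟨γ, hγ⟩ := hCcov n y hy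
      exact mem_iUnion.2 ⟨n, mem_iUnion.2 ⟨γ, hZV n γ ⟨hn, hγ⟩⟩⟩)
  refine ⟨fun γ => ⋃ n, E n ∩ closure (V n γ), fun γ => ?_, ?_, ?_, ?_, hEc.trans ?_⟩
  · exact (hElf.subset fun n => inter_subset_left).isClosed_iUnion
      fun n => (hE n).inter isClosed_closure
  · exact lf_biUnion hElf (U := fun n γ => closure (V n γ)) hVlf
  · exact fun γ => iUnion_subset fun n y hy => (hVW n γ hy.2).1
  · intro γ hγ
    rw [iUnion_eq_empty]
    intro n
    rw [eq_empty_iff_forall_notMem]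
    exact fun y hy => hγ (hVW n γ hy.2).2
  · refine interior_mono (iUnion_subset fun n y hy => ?_)
    obtain ⟨γ, hγ⟩ := mem_iUnion.1 (hEV n hy)
    exact mem_iUnion.2 ⟨γ, mem_iUnion.2 ⟨n, hy, subset_closure hγ⟩⟩

theorem michael_all {X Y Γ : Type*} [TopologicalSpace X] [TopologicalSpace Y] [NormalSpace Y]
    [LinearOrder Γ] [WellFoundedLT Γ] {q : X → Y} (hqc : Continuous q) (hqcl : IsClosedMap q)
    (hC : CLF Y) (hD : DCW Γ Y) : Sst q (Set.univ : Set Γ) := by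
  have : ∀ j : Γ, Sst q (Set.Iio j) := by
    intro j
    induction j using WellFoundedLT.induction with
    | ind j ih =>
      exact michael_lim hqc hqcl hC hD (isLowerSet_Iio j) fun i hi => (ih i hi).succ hqcl
  exact michael_lim hqc hqcl hC hD isLowerSet_univ fun i _ => (this i).succ hqcl

theorem CLF_of_prod {X T : Type*} [TopologicalSpace X] [TopologicalSpace T] [CompactSpace T]
    [T2Space T] [Infinite T] [NormalSpace X] [NormalSpace (X × T)] : CLF X := by
  classical
  obtain ⟨B, hBinf, hBo, hBd⟩ := exists_seq_infinite_isOpen_pairwise_disjoint T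
  choose t ht using fun n => (hBinf n).nonempty
  refine CLF_of_incr fun V hV hmono hcov => ?_
  let L : ℕ → Set T := fun n => (⋃ k ∈ Finset.range n, B k)ᶜ
  have hL : ∀ n, IsClosed (L n) := fun n =>
    (isOpen_biUnion fun k _ => hBo k).isClosed_compl
  have hLanti : Antitone L := by
    intro m n hmn
    refine compl_subset_compl.2 (biUnion_subset_biUnion_left ?_)
    intro k hk
    simp only [Finset.coe_range, mem_Iio] at *
    omega
  have htL : ∀ n, t n ∈ L n := by
    intro n hn
    simp only [mem_iUnion, Finset.mem_range] at hn
    obtain ⟨k, hk, hn⟩ := hn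
    exact Set.disjoint_left.1 (hBd hk.ne) hn (ht n)
  let H : Set (X × T) := univ ×ˢ (⋂ n, L n)
  let K : Set (X × T) := ⋃ n, (V n)ᶜ ×ˢ {t n}
  have hH : IsClosed H := isClosed_univ.prod (isClosed_iInter hL)
  have hK : IsClosed K := by
    refine LocallyFinite.isClosed_iUnion ?_ fun n => (hV n).isClosed_compl.prod isClosed_singleton
    rintro ⟨x, s⟩
    obtain ⟨m, hm⟩ := mem_iUnion.1 (hcov.symm ▸ mem_univ x : x ∈ ⋃ n, V n)
    refine ⟨Prod.fst ⁻¹' V m, ((hV m).preimage continuous_fst).mem_nhds hm,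
      (Set.finite_Iio m).subset ?_⟩
    rintro n ⟨⟨y, r⟩, ⟨h1, h2⟩, h3⟩
    by_contra hn
    exact h1 (hmono (not_lt.1 hn) h3)
  have hHK : Disjoint H K := by
    rw [Set.disjoint_left]
    rintro ⟨x, s⟩ ⟨_, h1⟩ h2
    obtain ⟨n, h2, h3⟩ := mem_iUnion.1 h2
    have h3 : s = t n := h3
    subst h3
    have := mem_iInter.1 h1 (n + 1)
    exact this (mem_iUnion₂.2 ⟨n, by simp, ht n⟩)
  obtain ⟨φ, hφ0, hφ1, -⟩ := exists_continuous_zero_one_of_isClosed hH hK hHK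
  refine ⟨fun n => {x | ∀ s ∈ L n, φ (x, s) ≤ 1 / 2}, fun n => ?_, fun n x hx => ?_, ?_⟩
  · simp only [setOf_forall]
    exact isClosed_iInter fun s => isClosed_iInter fun _ =>
      isClosed_le (by fun_prop) continuous_const
  · by_contra hxn
    have h1 : φ (x, t n) = 1 := hφ1 (mem_iUnion.2 ⟨n, hxn, rfl⟩)
    have h2 := hx (t n) (htL n)
    rw [h1] at h2
    norm_num at h2
  · rw [eq_univ_iff_forall]
    intro x
    by_contra hx
    simp only [mem_iUnion, not_exists] at hx
    have hne : (⋂ n, L n ∩ {s | 1 / 2 ≤ φ (x, s)}).Nonempty := by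
      refine IsCompact.nonempty_iInter_of_directed_nonempty_isCompact_isClosed _ ?_ ?_ ?_ ?_
      · exact directed_of_isDirected_le fun m n hmn => inter_subset_inter_left _ (hLanti hmn)
      · intro n
        have := hx n
        simp only [mem_setOf_eq, not_forall, not_le] at this
        obtain ⟨s, hs, h⟩ := this
        exact ⟨s, hs, h.le⟩
      · exact fun n => ((hL n).inter (isClosed_le continuous_const (by fun_prop))).isCompact
      · exact fun n => ((hL n).inter (isClosed_le continuous_const (by fun_prop)))
    obtain ⟨s, hs⟩ := hne
    rw [mem_iInter] at hs
    have h0 : φ (x, s) = 0 := hφ0 ⟨mem_univ _, mem_iInter.2 fun n => (hs n).1⟩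
    have h2 : 1 / 2 ≤ φ (x, s) := (hs 0).2
    rw [h0] at h2
    norm_num at h2

/-- indices which separate some points not separated before -/
def Irr {T S : Type*} [LT S] (e : S → T → ℝ) : Set S :=
  {g | ∃ s t, (∀ l < g, e l s = e l t) ∧ e g s ≠ e g t}

/-- locally finite expansion property for families supported on `J` -/
def LFE {S : Type*} (X : Type*) [TopologicalSpace X] (J : Set S) : Prop :=
  ∀ D : S → Set X, (∀ i, IsClosed (D i)) → LocallyFinite D →
    (∀ i j, i ≠ j → Disjoint (D i) (D j)) → (∀ i, (D i).Nonempty → i ∈ J) →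
    ∃ U : S → Set X, (∀ i, IsOpen (U i)) ∧ (∀ i, D i ⊆ U i) ∧ LocallyFinite U

theorem normal_prod_range {X T R : Type*} [TopologicalSpace X] [TopologicalSpace T]
    [TopologicalSpace R] [T2Space R] [CompactSpace T] [NormalSpace (X × T)]
    (ev : T → R) (hev : Continuous ev) (hs : Function.Surjective ev) : NormalSpace (X × R) := by
  have hp : IsProperMap (Prod.map (id : X → X) ev) :=
    IsProperMap.prodMap (Homeomorph.refl X).isProperMap hev.isProperMap
  exact normal_of_closed_map _ hp.continuous hp.isClosedMap
    (Function.surjective_id.prodMap hs)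

theorem LFE_lim {X T S : Type*} [TopologicalSpace X] [TopologicalSpace T] [CompactSpace T]
    [NormalSpace (X × T)] [LinearOrder S] (e : S → T → ℝ)
    (he : ∀ l, Continuous (e l)) {J : Set S} (hJ : IsLowerSet J)
    (h : ∀ j ∈ J, LFE X (Irr e ∩ Set.Iio j)) : LFE X (Irr e ∩ J) := by
  classical
  intro D hD hlf hdis hne
  rcases J.eq_empty_or_nonempty with rfl | hJne
  · refine ⟨fun _ => ∅, fun _ => isOpen_empty, fun i x hx => ?_, ?_⟩
    · exact (hne i ⟨x, hx⟩).2
    · intro x; exact ⟨univ, Filter.univ_mem, by simp⟩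
  choose s t hst1 hst2 using fun g : Irr e => g.2
  let ev : T → (J → ℝ) := fun r l => e l r
  have hev : Continuous ev := continuous_pi fun l => he l
  let ev' : T → range ev := rangeFactorization ev
  have hev' : Continuous ev' := hev.subtype_mk _
  haveI : NormalSpace (X × range ev) := normal_prod_range ev' hev' rangeFactorization_surjective
  have hcl : ∀ a : Irr e → T, IsClosed (⋃ g : Irr e, D g ×ˢ {ev' (a g)}) := by
    intro a
    refine LocallyFinite.isClosed_iUnion ?_ fun g => (hD g).prod isClosed_singleton
    exact (hlf.comp_injective Subtype.val_injective).prod_right _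
  have hdj : Disjoint (⋃ g : Irr e, D g ×ˢ {ev' (s g)}) (⋃ g : Irr e, D g ×ˢ {ev' (t g)}) := by
    rw [Set.disjoint_left]
    rintro ⟨x, r⟩ h1 h2
    obtain ⟨g, h1, h1'⟩ := mem_iUnion.1 h1
    obtain ⟨k, h2, h2'⟩ := mem_iUnion.1 h2
    have hgk : g = k := by
      by_contra hgk
      exact Set.disjoint_left.1 (hdis g k fun hh => hgk (Subtype.ext hh)) h1 h2
    subst hgk
    have h3 : ev' (s g) = ev' (t g) := (Eq.symm h1').trans h2'
    have h4 : ev (s g) = ev (t g) := congrArg Subtype.val h3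
    exact hst2 g (congrFun h4 ⟨g, (hne g ⟨x, h1⟩).2⟩)
  obtain ⟨ψ, hψ0, hψ1, -⟩ := exists_continuous_zero_one_of_isClosed (hcl s) (hcl t) hdj
  let M : Set C(T, ℝ) := {f | ∀ a b, (∀ l ∈ J, e l a = e l b) → f a = f b}
  let φ0 : C(X, C(T, ℝ)) := ContinuousMap.curry ⟨fun p : X × T => ψ (p.1, ev' p.2), by fun_prop⟩
  have hφ0 : ∀ x r, φ0 x r = ψ (x, ev' r) := fun x r => rfl
  have hφM : ∀ x, φ0 x ∈ M := by
    intro x a b hab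
    have : ev' a = ev' b := Subtype.ext (funext fun l => hab l l.2)
    rw [hφ0, hφ0, this]
  let φ : X → M := fun x => ⟨φ0 x, hφM x⟩
  have hφ : Continuous φ := φ0.continuous.subtype_mk _
  let Q : S → Set (T × T) := fun j => {p | ∀ l ≤ j, e l p.1 = e l p.2}
  have hQ : ∀ j, IsClosed (Q j) := by
    intro j
    simp only [Q, ofPred_forall]
    exact isClosed_iInter fun l => isClosed_iInter fun _ =>
      isClosed_eq ((he l).comp continuous_fst) ((he l).comp continuous_snd)
  let V : J → Set M := fun j => {f | ∀ p ∈ Q j, |f.1 p.1 - f.1 p.2| < 1}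
  have hV : ∀ j, IsOpen (V j) := by
    intro j
    refine isOpen_forall_compact (N := {z : M × (T × T) | |z.1.1 z.2.1 - z.1.1 z.2.2| < 1})
      (hQ j).isCompact ?_
    exact isOpen_lt (by fun_prop) continuous_const
  have hVc : (⋃ j, V j) = univ := by
    rw [eq_univ_iff_forall]
    intro f
    by_contra hf
    simp only [mem_iUnion, not_exists] at hf
    have hcl2 : ∀ j : J, IsClosed (Q j ∩ {p | 1 ≤ |f.1 p.1 - f.1 p.2|}) := fun j =>
      (hQ j).inter (isClosed_le continuous_const (by fun_prop))
    haveI : Nonempty J := hJne.to_subtype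
    have hne : (⋂ j : J, Q j ∩ {p | 1 ≤ |f.1 p.1 - f.1 p.2|}).Nonempty := by
      refine IsCompact.nonempty_iInter_of_directed_nonempty_isCompact_isClosed _ ?_ ?_
        (fun j => (hcl2 j).isCompact) hcl2
      · refine directed_of_isDirected_le fun m n hmn => inter_subset_inter_left _ ?_
        exact fun p hp l hl => hp l (hl.trans hmn)
      · intro j
        have := hf j
        simp only [V, mem_ofPred_eq, not_forall, not_lt] at this
        obtain ⟨p, hp, h⟩ := this
        exact ⟨p, hp, h⟩
    obtain ⟨p, hp⟩ := hne
    rw [mem_iInter] at hp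
    have h1 : f.1 p.1 = f.1 p.2 := f.2 _ _ fun l hl => (hp ⟨l, hl⟩).1 l le_rfl
    have h2 : 1 ≤ |f.1 p.1 - f.1 p.2| := (hp (Classical.arbitrary J)).2
    rw [h1] at h2
    norm_num at h2
  obtain ⟨V', hV'o, hV'c, hV'lf, hV'V⟩ := precise_refinement V hV hVc
  have hgj : ∀ (j : J) g x, x ∈ D g → φ x ∈ V' j → g ≤ j := by
    intro j g x hx hφx
    by_contra hlt
    rw [not_le] at hlt
    have hg := hne g ⟨x, hx⟩
    have h1 := hV'V j hφx (s ⟨g, hg.1⟩, t ⟨g, hg.1⟩) fun l hl => hst1 ⟨g, hg.1⟩ l (hl.trans_lt hlt)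
    have h2 : φ0 x (s ⟨g, hg.1⟩) = 0 := hψ0 (mem_iUnion.2 ⟨⟨g, hg.1⟩, hx, rfl⟩)
    have h3 : φ0 x (t ⟨g, hg.1⟩) = 1 := hψ1 (mem_iUnion.2 ⟨⟨g, hg.1⟩, hx, rfl⟩)
    change |φ0 x (s ⟨g, hg.1⟩) - φ0 x (t ⟨g, hg.1⟩)| < 1 at h1
    rw [h2, h3] at h1
    norm_num at h1
  have hex : ∀ j : J, ∃ U : S → Set X, (∀ i, IsOpen (U i)) ∧
      (∀ i, {x | x ∈ D i ∧ i < j} ⊆ U i) ∧ LocallyFinite U := by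
    intro j
    refine h j j.2 (fun i => {x | x ∈ D i ∧ i < j}) (fun i => ?_) (hlf.subset fun i x hx => hx.1)
      (fun i k hik => (hdis i k hik).mono (fun x hx => hx.1) (fun x hx => hx.1)) ?_
    · by_cases hi : i < j
      · simpa [hi] using hD i
      · simp [hi]
    · rintro i ⟨x, hx, hi⟩
      exact ⟨(hne i ⟨x, hx⟩).1, hi⟩
  choose U hU hDU hUlf using hex
  refine ⟨fun i => ⋃ j : J, φ ⁻¹' V' j ∩ (U j i ∪ {_x | i = j}), fun i => ?_, fun i x hx => ?_, ?_⟩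
  · refine isOpen_iUnion fun j => ((hV'o j).preimage hφ).inter ((hU j i).union ?_)
    exact isOpen_const
  · obtain ⟨j, hj⟩ := mem_iUnion.1 (hV'c.symm ▸ mem_univ (φ x) : φ x ∈ ⋃ j, V' j)
    refine mem_iUnion.2 ⟨j, hj, ?_⟩
    rcases (hgj j i x hx hj).lt_or_eq with hlt | heq
    · exact Or.inl (hDU j i ⟨hx, hlt⟩)
    · exact Or.inr heq
  · refine lf_biUnion (hV'lf.preimage_continuous hφ) (U := fun j i => U j i ∪ {_x | i = j})
      fun j => ?_
    intro x
    obtain ⟨N, hN, hf⟩ := hUlf j x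
    refine ⟨N, hN, (hf.union (Set.finite_singleton j.1)).subset ?_⟩
    rintro i ⟨z, hz | hz, hzN⟩
    · exact Or.inl ⟨z, hz, hzN⟩
    · exact Or.inr hz

theorem LFE_all {X T S : Type*} [TopologicalSpace X] [TopologicalSpace T] [CompactSpace T]
    [NormalSpace (X × T)] [LinearOrder S] [WellFoundedLT S] (e : S → T → ℝ)
    (he : ∀ l, Continuous (e l)) : LFE X (Irr e) := by
  have : ∀ j : S, LFE X (Irr e ∩ Set.Iio j) := by
    intro j
    induction j using WellFoundedLT.induction with
    | ind j ih => exact LFE_lim e he (isLowerSet_Iio j) fun i hi => ih i hi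
  have h2 := LFE_lim (X := X) e he isLowerSet_univ fun i _ => this i
  rwa [inter_univ] at h2

theorem DCW_Irr {X T S : Type*} [TopologicalSpace X] [TopologicalSpace T] [CompactSpace T]
    [NormalSpace X] [NormalSpace (X × T)] [LinearOrder S] [WellFoundedLT S] (e : S → T → ℝ)
    (he : ∀ l, Continuous (e l)) : DCW (Irr e) X := by
  refine DCW_of_lf fun D hD hlf hdis => ?_
  have key : ∀ b : S, (∃ hb : b ∈ Irr e,
      (⋃ a : Irr e, ⋃ (_ : (a : S) = b), D a) = D ⟨b, hb⟩) ∨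
      (b ∉ Irr e ∧ (⋃ a : Irr e, ⋃ (_ : (a : S) = b), D a) = ∅) := by
    intro b
    by_cases hb : b ∈ Irr e
    · refine Or.inl ⟨hb, ?_⟩
      ext x
      simp only [mem_iUnion]
      constructor
      · rintro ⟨a, rfl, h⟩; exact h
      · intro h; exact ⟨⟨b, hb⟩, rfl, h⟩
    · refine Or.inr ⟨hb, ?_⟩
      ext x
      simp only [mem_iUnion, mem_empty_iff_false, iff_false]
      rintro ⟨a, rfl, h⟩
      exact hb a.2
  have h1 : ∀ b : S, IsClosed (⋃ a : Irr e, ⋃ (_ : (a : S) = b), D a) := by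
    intro b
    rcases key b with ⟨hb, h⟩ | ⟨hb, h⟩
    · rw [h]; exact hD _
    · rw [h]; exact isClosed_empty
  have h2 : ∀ b c : S, b ≠ c → Disjoint (⋃ a : Irr e, ⋃ (_ : (a : S) = b), D a)
      (⋃ a : Irr e, ⋃ (_ : (a : S) = c), D a) := by
    intro b c hbc
    rw [Set.disjoint_left]
    intro x hx hx'
    simp only [mem_iUnion] at hx hx'
    obtain ⟨a, rfl, h1⟩ := hx
    obtain ⟨a', rfl, h2⟩ := hx'
    exact Set.disjoint_left.1 (hdis a a' fun h => hbc (congrArg _ h)) h1 h2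
  have h3 : ∀ b : S, (⋃ a : Irr e, ⋃ (_ : (a : S) = b), D a).Nonempty → b ∈ Irr e := by
    intro b hb
    rcases key b with ⟨hb', h⟩ | ⟨hb', h⟩
    · exact hb'
    · rw [h] at hb; exact absurd hb Set.not_nonempty_empty
  obtain ⟨U, hU, hDU, hUlf⟩ := LFE_all (X := X) e he _ h1
    (lf_extend _ Subtype.val_injective hlf) h2 h3
  refine ⟨fun a => U a, fun a => hU a, fun a x hx => hDU a ?_,
      hUlf.comp_injective Subtype.val_injective⟩
  exact mem_iUnion.2 ⟨a, mem_iUnion.2 ⟨rfl, hx⟩⟩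

theorem Irr_sep {T S : Type*} [LinearOrder S] [WellFoundedLT S] (e : S → T → ℝ)
    {a b : T} (h : ∃ g, e g a ≠ e g b) : ∃ g ∈ Irr e, e g a ≠ e g b := by
  obtain ⟨g, hg, hmin⟩ := WellFounded.has_min (r := fun a b : S => a < b) wellFounded_lt
      {g | e g a ≠ e g b} h
  refine ⟨g, ⟨a, b, fun l hl => ?_, hg⟩, hg⟩
  by_contra hne
  exact hmin l hne hl

theorem dense_adjoin {T : Type*} [TopologicalSpace T] [CompactSpace T] (s : Set C(T, ℝ))
    (hs : ∀ a b : T, a ≠ b → ∃ f ∈ s, f a ≠ f b) :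
    closure (Algebra.adjoin ℚ s : Set C(T, ℝ)) = univ := by
  let A : Subring C(T, ℝ) := (Algebra.adjoin ℚ s).toSubring.topologicalClosure
  have hA : (A : Set C(T, ℝ)) = closure (Algebra.adjoin ℚ s : Set C(T, ℝ)) := rfl
  have hcl : IsClosed (A : Set C(T, ℝ)) := Subring.isClosed_topologicalClosure _
  have hsub : (Algebra.adjoin ℚ s : Set C(T, ℝ)) ⊆ A := subset_closure
  have hc : ∀ r : ℝ, algebraMap ℝ C(T, ℝ) r ∈ A := by
    intro r
    have hcont : Continuous (fun r : ℝ => algebraMap ℝ C(T, ℝ) r) := continuous_algebraMap _ _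
    have h1 : IsClosed {r : ℝ | algebraMap ℝ C(T, ℝ) r ∈ A} := hcl.preimage hcont
    have h2 : range ((↑) : ℚ → ℝ) ⊆ {r : ℝ | algebraMap ℝ C(T, ℝ) r ∈ A} := by
      rintro _ ⟨z, rfl⟩
      have : algebraMap ℝ C(T, ℝ) (z : ℝ) = algebraMap ℚ C(T, ℝ) z := by
        ext x
        rfl
      change algebraMap ℝ C(T, ℝ) (z : ℝ) ∈ A
      rw [this]
      exact hsub ((Algebra.adjoin ℚ s).algebraMap_mem z)
    have h3 := h1.closure_subset_iff.2 h2
    rw [Rat.denseRange_cast.closure_range] at h3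
    exact h3 (mem_univ r)
  let B : Subalgebra ℝ C(T, ℝ) := { A.toSubsemiring with algebraMap_mem' := hc }
  have hB : (B : Set C(T, ℝ)) = A := rfl
  have hsep : B.SeparatesPoints := by
    intro a b hab
    obtain ⟨f, hf, hne⟩ := hs a b hab
    exact ⟨f, ⟨f, hsub (Algebra.subset_adjoin hf), rfl⟩, hne⟩
  have h := ContinuousMap.subalgebra_topologicalClosure_eq_top_of_separatesPoints B hsep
  rw [← hA, eq_univ_iff_forall]
  intro f
  have hf : f ∈ B.topologicalClosure := by rw [h]; trivial
  have hf' : f ∈ closure (B : Set C(T, ℝ)) := hf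
  rw [hB, hcl.closure_eq] at hf'
  exact hf'

theorem exists_dense_DCW (X T : Type*) [TopologicalSpace X] [TopologicalSpace T] [CompactSpace T]
    [T2Space T] [NormalSpace X] [NormalSpace (X × T)] :
    ∃ 𝒢 : Set C(T, ℝ), Dense 𝒢 ∧ DCW 𝒢 X := by
  have : ∃ (S : Type _) (e : S → C(T, ℝ)), Function.Bijective e :=
    ⟨C(T, ℝ), id, Function.bijective_id⟩
  obtain ⟨S, e, he⟩ := this
  obtain ⟨_, _⟩ := exists_wellFoundedLT S
  let e' : S → T → ℝ := fun l => e l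
  have hI : DCW (Irr e') X := DCW_Irr e' fun l => (e l).continuous
  refine ⟨Algebra.adjoin ℚ (e '' Irr e'), ?_, ?_⟩
  · rw [dense_iff_closure_eq]
    refine dense_adjoin _ fun a b hab => ?_
    have : ∃ f : C(T, ℝ), f a ≠ f b := by
      obtain ⟨f, h0, h1, -⟩ := exists_continuous_zero_one_of_isClosed (isClosed_singleton (x := a))
        (isClosed_singleton (x := b)) (by simpa using hab)
      refine ⟨f, ?_⟩
      rw [h0 rfl, h1 rfl]
      norm_num
    obtain ⟨f, hf⟩ := this
    obtain ⟨l, rfl⟩ := he.2 f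
    obtain ⟨g, hg, hne⟩ := Irr_sep e' ⟨l, hf⟩
    exact ⟨e g, ⟨g, hg, rfl⟩, hne⟩
  · have hcard := Algebra.lift_cardinalMk_adjoin_le ℚ (e '' Irr e')
    simp only [Cardinal.lift_id', Cardinal.lift_uzero] at hcard
    by_cases hfin : (Irr e').Finite
    · have : Countable (Algebra.adjoin ℚ (e '' Irr e')) := by
        rw [← Cardinal.mk_le_aleph0_iff]
        refine hcard.trans ?_
        have := (hfin.image e).countable.le_aleph0
        simp [this]
      obtain ⟨f, hf⟩ := exists_injective_nat (Algebra.adjoin ℚ (e '' Irr e'))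
      exact DCW_nat.of_injective f hf
    · have hinf : Infinite (e '' Irr e') :=
        (Set.Infinite.image he.1.injOn hfin).to_subtype
      have : Cardinal.mk (Algebra.adjoin ℚ (e '' Irr e')) ≤ Cardinal.mk (e '' Irr e') := by
        refine hcard.trans ?_
        have := Cardinal.aleph0_le_mk (e '' Irr e')
        simp [this]
      obtain ⟨f⟩ := Cardinal.le_def _ _ |>.1 this
      let k : Irr e' ≃ e '' Irr e' := Equiv.Set.image e _ he.1
      exact hI.of_injective (fun z => k.symm (f z)) (k.symm.injective.comp f.injective)

theorem final_inf {T X Y : Type*} [TopologicalSpace T] [TopologicalSpace X] [TopologicalSpace Y]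
    [CompactSpace T] [T2Space T] [Infinite T] [NormalSpace X] [NormalSpace (X × T)]
    (q : X → Y) (hqc : Continuous q) (hqcl : IsClosedMap q) (hqs : Function.Surjective q) :
    NormalSpace (Y × T) := by
  have hYn : NormalSpace Y := normal_of_closed_map q hqc hqcl hqs
  obtain ⟨𝒢, h𝒢, hDX⟩ := exists_dense_DCW X T
  have hC : CLF Y := (CLF_of_prod (X := X) (T := T)).of_closed_map q hqc hqcl hqs
  have hDY : DCW 𝒢 Y := hDX.of_closed_map q hqc hqcl hqs
  have : ∃ (Γ : Type _) (g : Γ → C(T, ℝ)), DenseRange g ∧ DCW Γ Y :=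
    ⟨𝒢, Subtype.val, by rw [DenseRange, Subtype.range_val]; exact h𝒢, hDY⟩
  obtain ⟨Γ, g, hg, hΓ⟩ := this
  obtain ⟨_, _⟩ := exists_wellFoundedLT Γ
  refine ⟨fun H K hH hK hHK => ?_⟩
  have hm : Continuous (Prod.map q (id : T → T)) := hqc.prodMap continuous_id
  obtain ⟨φ1, hφ0, hφ1, -⟩ := exists_continuous_zero_one_of_isClosed (hH.preimage hm)
    (hK.preimage hm) (hHK.preimage _)
  let φ : C(X, C(T, ℝ)) := φ1.curry
  have hbc : (⋃ γ, Metric.ball (g γ) (1 / 4)) = univ := by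
    rw [eq_univ_iff_forall]
    intro f
    obtain ⟨γ, hγ⟩ := hg.exists_dist_lt f (show (0 : ℝ) < 1 / 4 by norm_num)
    exact mem_iUnion.2 ⟨γ, hγ⟩
  obtain ⟨v, hvo, hvc, hvlf, hvb⟩ := precise_refinement (fun γ => Metric.ball (g γ) (1 / 4))
    (fun γ => Metric.isOpen_ball) hbc
  obtain ⟨F', hF'c, hF'cl, hF'v⟩ := exists_iUnion_eq_closed_subset hvo
    (fun f => hvlf.point_finite f) hvc
  have hF'b : ∀ γ, F' γ ⊆ Metric.ball (g γ) (1 / 4) := fun γ => (hF'v γ).trans (hvb γ)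
  let P : Γ → Set (Y × T) := fun γ => {p | (p ∈ H → g γ p.2 < 1 / 2) ∧ (p ∈ K → 1 / 2 < g γ p.2)}
  have hP : ∀ γ, IsOpen (P γ) := by
    intro γ
    have : P γ = (Hᶜ ∪ {p | g γ p.2 < 1 / 2}) ∩ (Kᶜ ∪ {p | 1 / 2 < g γ p.2}) := by
      ext p
      simp only [P, mem_ofPred_eq, mem_inter_iff, mem_union, mem_compl_iff, imp_iff_not_or]
    rw [this]
    exact (hH.isOpen_compl.union (isOpen_lt (by fun_prop) continuous_const)).inter
      (hK.isOpen_compl.union (isOpen_lt continuous_const (by fun_prop)))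
  let O : Γ → Set Y := fun γ => {y | ∀ t ∈ (univ : Set T), (y, t) ∈ P γ}
  have hO : ∀ γ, IsOpen (O γ) := fun γ => isOpen_forall_compact isCompact_univ (hP γ)
  have hnear : ∀ γ x, φ x ∈ F' γ → ∀ t, |φ1 (x, t) - g γ t| < 1 / 4 := by
    intro γ x hx t
    have h1 : dist (φ x) (g γ) < 1 / 4 := hF'b γ hx
    have h2 := ContinuousMap.dist_apply_le_dist (f := φ x) (g := g γ) t
    rw [Real.dist_eq] at h2
    exact h2.trans_lt h1
  have hS : Sys q univ (fun γ => φ ⁻¹' F' γ) O := by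
    refine ⟨fun γ => (hF'cl γ).preimage φ.continuous,
      (hvlf.subset hF'v).preimage_continuous φ.continuous, hO, ?_, fun γ hγ => absurd trivial hγ⟩
    rintro γ _ ⟨x, hx, rfl⟩ t -
    have h := abs_lt.1 (hnear γ x hx t)
    constructor
    · intro hp
      have h0 : φ1 (x, t) = 0 := hφ0 hp
      rw [h0] at h
      change g γ t < 1 / 2
      linarith [h.1]
    · intro hp
      have h0 : φ1 (x, t) = 1 := hφ1 hp
      rw [h0] at h
      change 1 / 2 < g γ t
      linarith [h.2]
  obtain ⟨E, hE, hElf, hEW, -, hEc⟩ := michael_all hqc hqcl hC hΓ _ _ hS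
  have hEO : ∀ γ, E γ ⊆ O γ := fun γ => (hEW γ).trans sdiff_subset
  have hEu : ∀ y, ∃ γ, y ∈ E γ := by
    intro y
    obtain ⟨x, rfl⟩ := hqs y
    refine mem_iUnion.1 (interior_subset (hEc ⟨x, ?_, rfl⟩))
    obtain ⟨γ, hγ⟩ := mem_iUnion.1 (hF'c.symm ▸ mem_univ (φ x) : φ x ∈ ⋃ γ, F' γ)
    exact mem_iUnion.2 ⟨γ, hγ⟩
  refine ⟨(⋃ γ, E γ ×ˢ {t | 1 / 2 ≤ g γ t})ᶜ, (⋃ γ, E γ ×ˢ {t | g γ t ≤ 1 / 2})ᶜ, ?_, ?_, ?_, ?_, ?_⟩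
  · refine (LocallyFinite.isClosed_iUnion (hElf.prod_right _) fun γ =>
      (hE γ).prod (isClosed_le continuous_const (by fun_prop))).isOpen_compl
  · refine (LocallyFinite.isClosed_iUnion (hElf.prod_right _) fun γ =>
      (hE γ).prod (isClosed_le (by fun_prop) continuous_const)).isOpen_compl
  · rintro ⟨y, t⟩ hp hp'
    obtain ⟨γ, h1, h2⟩ := mem_iUnion.1 hp'
    exact absurd ((hEO γ h1 t trivial).1 hp) (not_lt.2 h2)
  · rintro ⟨y, t⟩ hp hp'
    obtain ⟨γ, h1, h2⟩ := mem_iUnion.1 hp'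
    exact absurd ((hEO γ h1 t trivial).2 hp) (not_lt.2 h2)
  · rw [Set.disjoint_left]
    rintro ⟨y, t⟩ h1 h2
    obtain ⟨γ, hγ⟩ := hEu y
    rcases le_total (g γ t) (1 / 2) with h | h
    · exact h2 (mem_iUnion.2 ⟨γ, hγ, h⟩)
    · exact h1 (mem_iUnion.2 ⟨γ, hγ, h⟩)

theorem final_fin {T X Y : Type*} [TopologicalSpace T] [TopologicalSpace X] [TopologicalSpace Y]
    [T2Space T] [Finite T] [NormalSpace (X × T)]
    (q : X → Y) (hqc : Continuous q) (hqcl : IsClosedMap q) (hqs : Function.Surjective q) :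
    NormalSpace (Y × T) := by
  refine normal_of_closed_map (Prod.map q (id : T → T)) (hqc.prodMap continuous_id) ?_
    (hqs.prodMap Function.surjective_id)
  intro E hE
  have : Prod.map q (id : T → T) '' E = ⋃ t : T, (q '' {x | (x, t) ∈ E}) ×ˢ {t} := by
    ext ⟨y, t⟩
    constructor
    · rintro ⟨⟨x, s⟩, h, heq⟩
      simp only [Prod.map_apply, id, Prod.mk.injEq] at heq
      obtain ⟨rfl, rfl⟩ := heq
      exact mem_iUnion.2 ⟨s, ⟨x, h, rfl⟩, rfl⟩
    · intro h
      obtain ⟨s, ⟨x, hx, h1⟩, h2⟩ := mem_iUnion.1 h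
      have h1 : q x = y := h1
      have h2 : t = s := h2
      subst h1 h2
      exact ⟨(x, t), hx, rfl⟩
  rw [this]
  exact isClosed_iUnion_of_finite fun t =>
    (hqcl _ (hE.preimage (Continuous.prodMk_left t))).prod isClosed_singleton

/-- (Rudin) If `T` is compact Hausdorff, `X` is normal Hausdorff, `q : X → Y` is a continuous
closed surjection onto a Hausdorff space `Y`, and `X × T` is normal, then `Y × T` is normal. -/
theorem stmt_13 {T X Y : Type*} [TopologicalSpace T] [TopologicalSpace X] [TopologicalSpace Y]
    [CompactSpace T] [T2Space T] [T2Space Y]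
    (hX : IsNormalHausdorff X)
    (q : X → Y) (hqc : Continuous q) (hqcl : IsClosedMap q) (hqs : Function.Surjective q)
    (h : IsNormalHausdorff (X × T)) : IsNormalHausdorff (Y × T) := by
  obtain ⟨_, _⟩ := hX
  obtain ⟨_, _⟩ := h
  refine ⟨?_, inferInstance⟩
  rcases finite_or_infinite T with _ | _
  · exact final_fin q hqc hqcl hqs
  · exact final_inf q hqc hqcl hqs
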